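/- Fix Y ∈ ℝ. Let U : ℝ × ℝ → ℝ be C² on the strip ℝ × [Y,∞), subharmonic there (∂²U/∂x² + ∂²U/∂y² ≥ 0 at every point of the strip), 2π-periodic in the first variable (U(x+2π, y) = U(x, y) for all x ∈ ℝ, y ≥ Y), and assume the finite Dirichlet energy condition ∫_Y^∞ ∫₀^{2π} ((∂U/∂x)² + (∂U/∂y)²) dx dy < ∞. Define m(y) := (1/(2π)) ∫₀^{2π} U(x,y) dx and A(y) := (∫₀^{2π} (∂U/∂x)(x,y)² dx)^{1/2}. Then: (1) m is bounded above on [Y,∞); (2) for every y ≥ Y, U(0,y) ≤ sup_{t ≥ Y} m(t) + √(2π) · A(y). -/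

import Mathlib

open MeasureTheory Real Set intervalIntegral

/-- The partial derivative of `U : ℝ × ℝ → ℝ` in the first (x) variable. -/
noncomputable def pderivX (U : ℝ × ℝ → ℝ) (p : ℝ × ℝ) : ℝ :=
  deriv (fun x => U (x, p.2)) p.1

/-- The partial derivative of `U : ℝ × ℝ → ℝ` in the second (y) variable. -/
noncomputable def pderivY (U : ℝ × ℝ → ℝ) (p : ℝ × ℝ) : ℝ :=
  deriv (fun y => U (p.1, y)) p.2

/-- The mean of `U(·, y)` over one period `[0, 2π]`. -/
noncomputable def meanU (U : ℝ × ℝ → ℝ) (y : ℝ) : ℝ :=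
  (1 / (2 * π)) * ∫ x in (0:ℝ)..(2 * π), U (x, y)

/-- The `L²` norm in `x` of the `x`-derivative of `U` at height `y`. -/
noncomputable def L2x (U : ℝ × ℝ → ℝ) (y : ℝ) : ℝ :=
  Real.sqrt (∫ x in (0:ℝ)..(2 * π), (pderivX U (x, y)) ^ 2)


lemma cc_Y (n : ℕ) (Y : ℝ) (W : ℝ × ℝ → ℝ)
    (h : ContDiffOn ℝ (n+1 : ℕ) W (Set.univ ×ˢ Set.Ioi Y)) :
    ContDiffOn ℝ n (pderivY W) (Set.univ ×ˢ Set.Ioi Y) ∧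
    ∀ x y : ℝ, Y < y → HasDerivAt (fun y => W (x, y)) (pderivY W (x, y)) y := by
  have hO : IsOpen ((Set.univ : Set ℝ) ×ˢ Set.Ioi Y) := isOpen_univ.prod isOpen_Ioi
  have key : ∀ x y : ℝ, Y < y →
      HasDerivAt (fun y => W (x, y)) (fderiv ℝ W (x, y) (0, 1)) y := by
    intro x y hy
    have hd : DifferentiableAt ℝ W (x, y) :=
      ((h.contDiffAt (hO.mem_nhds (show (x, y) ∈ _ from ⟨trivial, hy⟩))).differentiableAt (by simp))
    have h2 : HasDerivAt (fun y : ℝ => (x, y)) ((0:ℝ), (1:ℝ)) y :=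
      (hasDerivAt_const y x).prodMk (hasDerivAt_id y)
    exact hd.hasFDerivAt.comp_hasDerivAt y h2
  have eq : ∀ x y : ℝ, Y < y → pderivY W (x, y) = fderiv ℝ W (x, y) (0, 1) :=
    fun x y hy => (key x y hy).deriv
  refine ⟨?_, fun x y hy => by rw [eq x y hy]; exact key x y hy⟩
  have h1 : ContDiffOn ℝ n (fun p => fderiv ℝ W p (0, 1)) (Set.univ ×ˢ Set.Ioi Y) :=
    (h.fderiv_of_isOpen hO (m := n) (by norm_cast)).clm_apply contDiffOn_const
  exact h1.congr (fun p hp => eq p.1 p.2 hp.2)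

lemma cc_diff (Y : ℝ) (W : ℝ × ℝ → ℝ)
    (h : ContDiffOn ℝ 1 W (Set.univ ×ˢ Set.Ioi Y)) (y : ℝ) (hy : Y < y) :
    HasDerivAt (fun y => ∫ x in (0:ℝ)..(2 * π), W (x, y))
      (∫ x in (0:ℝ)..(2 * π), pderivY W (x, y)) y := by
  obtain ⟨h0, hd⟩ := cc_Y 0 Y W (by simpa using h)
  have hc : ContinuousOn (pderivY W) (Set.univ ×ˢ Set.Ioi Y) := h0.continuousOn
  have slice : ∀ G : ℝ × ℝ → ℝ, ContinuousOn G (Set.univ ×ˢ Set.Ioi Y) → ∀ t, Y < t →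
      Continuous (fun x => G (x, t)) := fun G hG t ht =>
    hG.comp_continuous (by fun_prop) (fun x => ⟨trivial, ht⟩)
  obtain ⟨a, ha, hay⟩ := exists_between hy
  have hK : IsCompact (Set.Icc (0:ℝ) (2*π) ×ˢ Set.Icc a (y+1)) := isCompact_Icc.prod isCompact_Icc
  obtain ⟨C, hC⟩ := hK.exists_bound_of_continuousOn
    (hc.mono (fun p hp => ⟨trivial, lt_of_lt_of_le ha hp.2.1⟩))
  have hpi : (0:ℝ) ≤ 2 * π := by positivity
  refine (intervalIntegral.hasDerivAt_integral_of_dominated_loc_of_deriv_le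
    (F := fun y x => W (x, y)) (F' := fun y x => pderivY W (x, y)) (s := Set.Ioo a (y+1))
    (bound := fun _ => C) (Ioo_mem_nhds hay (by linarith)) ?_ ?_ ?_ ?_ ?_ ?_).2
  · filter_upwards [lt_mem_nhds hy] with t ht
    exact (slice W h.continuousOn t ht).aestronglyMeasurable
  · exact (slice W h.continuousOn y hy).intervalIntegrable _ _
  · exact (slice _ hc y hy).aestronglyMeasurable
  · refine Filter.Eventually.of_forall fun x hx t ht => hC (x, t) ⟨?_, ht.1.le, ht.2.le⟩
    rw [Set.uIoc_of_le hpi] at hx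
    exact ⟨hx.1.le, hx.2⟩
  · simp
  · exact Filter.Eventually.of_forall fun x hx t ht => hd x t (ha.trans ht.1)

lemma cc_CS (f : ℝ → ℝ) (hf : Continuous f) :
    (∫ x in (0:ℝ)..(2 * π), f x) ^ 2 ≤ 2 * π * ∫ x in (0:ℝ)..(2 * π), f x ^ 2 := by
  have hpi : (0:ℝ) < 2 * π := by positivity
  set I := ∫ x in (0:ℝ)..(2 * π), f x with hI
  have h0 : 0 ≤ ∫ x in (0:ℝ)..(2 * π), (2 * π * f x - I) ^ 2 :=
    intervalIntegral.integral_nonneg hpi.le (fun x _ => sq_nonneg _)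
  have h1 : ∫ x in (0:ℝ)..(2 * π), (2 * π * f x - I) ^ 2 =
      (2*π)^2 * (∫ x in (0:ℝ)..(2 * π), f x ^ 2) - (2 * (2 * π) * I) * I + 2 * π * I ^ 2 := by
    have : ∀ x, (2 * π * f x - I) ^ 2 =
      (2*π)^2 * f x ^ 2 - (2 * (2 * π) * I) * f x + I ^ 2 := fun x => by ring
    simp_rw [this]
    rw [intervalIntegral.integral_add, intervalIntegral.integral_sub,
      intervalIntegral.integral_const_mul, intervalIntegral.integral_const_mul, ← hI]
    · simp
    all_goals exact Continuous.intervalIntegrable (by fun_prop) _ _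
  rw [h1] at h0
  have : 0 ≤ (2 * π) * (2 * π * (∫ x in (0:ℝ)..(2 * π), f x ^ 2) - I ^ 2) := by nlinarith
  have := nonneg_of_mul_nonneg_right this hpi
  linarith

/-- Lemma 4.4 (lem:cusp-control): if `U` is `C²` on the strip `ℝ × [Y, ∞)`, subharmonic
there, `2π`-periodic in `x`, and has finite Dirichlet energy
`∫_Y^∞ ∫₀^{2π} (U_x² + U_y²) dx dy < ∞`, then (1) the mean function
`m(y) = (1/2π) ∫₀^{2π} U(x,y) dx` is bounded above on `[Y, ∞)`, and (2) for every `y ≥ Y`,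
`U(0,y) ≤ sup_{t ≥ Y} m(t) + √(2π) · A(y)` where `A(y)` is the `L²` norm in `x`
of `U_x(·, y)`. -/
theorem cusp_control
    (Y : ℝ) (U : ℝ × ℝ → ℝ)
    (hC2 : ContDiffOn ℝ 2 U (Set.univ ×ˢ Set.Ici Y))
    (hsub : ∀ p : ℝ × ℝ, Y ≤ p.2 →
      0 ≤ pderivX (pderivX U) p + pderivY (pderivY U) p)
    (hper : ∀ x y : ℝ, Y ≤ y → U (x + 2 * π, y) = U (x, y))
    (henergy : IntegrableOn (fun p : ℝ × ℝ => (pderivX U p) ^ 2 + (pderivY U p) ^ 2)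
      (Set.Icc 0 (2 * π) ×ˢ Set.Ici Y)) :
    BddAbove (meanU U '' Set.Ici Y) ∧
      ∀ y, Y ≤ y →
        U (0, y) ≤ sSup (meanU U '' Set.Ici Y) + Real.sqrt (2 * π) * L2x U y := by
  have hpi : (0:ℝ) < 2 * π := by positivity
  have hsl : ∀ y, Y ≤ y → ContDiff ℝ 2 (fun x => U (x, y)) := fun y hy =>
    contDiffOn_univ.1 (hC2.comp (t := Set.univ ×ˢ Set.Ici Y) (by fun_prop)
      (fun x _ => ⟨trivial, hy⟩))
  have hUx : ∀ y, Y ≤ y → ContDiff ℝ 1 (fun x => pderivX U (x, y)) := fun y hy =>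
    ((contDiff_succ_iff_deriv (n := 1)).1 (hsl y hy)).2.2
  have hUxx : ∀ y, Y ≤ y → Continuous (fun x => pderivX (pderivX U) (x, y)) := fun y hy =>
    (hUx y hy).continuous_deriv le_rfl
  have hUo : ContDiffOn ℝ 2 U (Set.univ ×ˢ Set.Ioi Y) :=
    hC2.mono (Set.prod_mono le_rfl Set.Ioi_subset_Ici_self)
  have hV := (cc_Y 1 Y U (by simpa using hUo)).1
  have hVV := (cc_Y 0 Y (pderivY U) (by simpa using hV)).1.continuousOn
  have slice : ∀ G : ℝ × ℝ → ℝ, ContinuousOn G (Set.univ ×ˢ Set.Ioi Y) → ∀ t, Y < t →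
      Continuous (fun x => G (x, t)) := fun G hG t ht =>
    hG.comp_continuous (by fun_prop) (fun x => ⟨trivial, ht⟩)
  set g : ℝ → ℝ := fun y => ∫ x in (0:ℝ)..(2 * π), pderivY U (x, y) with hg
  have hg' : ∀ y, Y < y → HasDerivAt g (∫ x in (0:ℝ)..(2 * π), pderivY (pderivY U) (x, y)) y :=
    fun y hy => cc_diff Y (pderivY U) (by simpa using hV) y hy
  have hxx0 : ∀ y, Y ≤ y → ∫ x in (0:ℝ)..(2 * π), pderivX (pderivX U) (x, y) = 0 := by
    intro y hy
    have h1 : ∫ x in (0:ℝ)..(2 * π), pderivX (pderivX U) (x, y) =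
        pderivX U (2 * π, y) - pderivX U (0, y) :=
      intervalIntegral.integral_eq_sub_of_hasDerivAt (f := fun x => pderivX U (x, y))
        (fun x _ => ((hUx y hy).differentiable (by simp) x).hasDerivAt)
        ((hUxx y hy).intervalIntegrable _ _)
    have h2 : pderivX U (0 + 2 * π, y) = pderivX U (0, y) := by
      have := deriv_comp_add_const (fun x => U (x, y)) (2 * π) 0
      simp only [hper _ y hy] at this
      exact this.symm
    rw [zero_add] at h2
    rw [h1, h2, sub_self]
  have hg'0 : ∀ y, Y < y → 0 ≤ ∫ x in (0:ℝ)..(2 * π), pderivY (pderivY U) (x, y) := by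
    intro y hy
    have h1 : 0 ≤ ∫ x in (0:ℝ)..(2 * π), (pderivX (pderivX U) (x, y) + pderivY (pderivY U) (x, y)) :=
      intervalIntegral.integral_nonneg hpi.le (fun x _ => hsub (x, y) hy.le)
    rwa [intervalIntegral.integral_add ((hUxx y hy.le).intervalIntegrable _ _)
      ((slice _ hVV y hy).intervalIntegrable _ _), hxx0 y hy.le, zero_add] at h1
  have hmono : MonotoneOn g (Set.Ioi Y) := by
    apply monotoneOn_of_deriv_nonneg (convex_Ioi Y)
    · exact fun y hy => (hg' y hy).continuousAt.continuousWithinAt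
    · rw [interior_Ioi]
      exact fun y hy => (hg' y hy).differentiableAt.differentiableWithinAt
    · rw [interior_Ioi]
      intro y hy
      rw [(hg' y hy).deriv]
      exact hg'0 y hy
  have hE : IntegrableOn (fun y => ∫ x in Set.Icc 0 (2 * π),
      ((pderivX U (x, y)) ^ 2 + (pderivY U (x, y)) ^ 2)) (Set.Ici Y) := by
    unfold IntegrableOn at henergy
    rw [Measure.volume_eq_prod, ← Measure.prod_restrict] at henergy
    exact henergy.integral_prod_right
  have hg0 : ∀ y, Y < y → g y ≤ 0 := by
    intro y hy
    by_contra! hpos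
    have hE' := hE.mono_set (Set.Ici_subset_Ici.2 hy.le)
    have hconst : IntegrableOn (fun _ : ℝ => (g y) ^ 2 / (2 * π)) (Set.Ici y) := by
      refine Integrable.mono' hE' aestronglyMeasurable_const ?_
      refine (ae_restrict_mem measurableSet_Ici).mono fun t ht => ?_
      have ht' : Y < t := lt_of_lt_of_le hy ht
      have cV := slice _ hV.continuousOn t ht'
      have cX := (hUx t ht'.le).continuous
      rw [Real.norm_of_nonneg (by positivity), integral_Icc_eq_integral_Ioc,
        ← intervalIntegral.integral_of_le hpi.le, div_le_iff₀' hpi]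
      have h1 : g y ≤ g t := hmono hy ht' ht
      have h2 := cc_CS _ cV
      have h3 : ∫ x in (0:ℝ)..(2 * π), pderivY U (x, t) ^ 2 ≤ ∫ x in (0:ℝ)..(2 * π),
          ((pderivX U (x, t)) ^ 2 + (pderivY U (x, t)) ^ 2) :=
        intervalIntegral.integral_mono_on hpi.le
          (Continuous.intervalIntegrable (by fun_prop) _ _)
          (Continuous.intervalIntegrable (by fun_prop) _ _)
          (fun x _ => le_add_of_nonneg_left (sq_nonneg _))
      calc g y ^ 2 ≤ g t ^ 2 := by gcongr
        _ ≤ _ := h2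
        _ ≤ _ := by gcongr
    rw [integrableOn_const_iff] at hconst
    rcases hconst with h | h
    · have : 0 < g y ^ 2 / (2 * π) := by positivity
      simp at h
      linarith
    · simp at h
  set M : ℝ → ℝ := fun y => ∫ x in (0:ℝ)..(2 * π), U (x, y) with hM
  have hMc : ContinuousOn M (Set.Ici Y) := by
    have hc : Continuous (fun p : ℝ × ℝ => U (p.2, max p.1 Y)) :=
      hC2.continuousOn.comp_continuous (by fun_prop) (fun p => ⟨trivial, le_max_right p.1 Y⟩)
    have h1 := intervalIntegral.continuous_parametric_intervalIntegral_of_continuous'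
      (μ := volume) (f := fun y x => U (x, max y Y)) hc 0 (2 * π)
    refine h1.continuousOn.congr fun y hy => ?_
    simp only [hM, max_eq_left (show Y ≤ y from hy)]
  have hMd : ∀ y, Y < y → HasDerivAt M (g y) y := fun y hy =>
    cc_diff Y U (hUo.of_le (by norm_num)) y hy
  have hanti : AntitoneOn M (Set.Ici Y) := by
    apply antitoneOn_of_deriv_nonpos (convex_Ici Y) hMc
    · rw [interior_Ici]
      exact fun y hy => (hMd y hy).differentiableAt.differentiableWithinAt
    · rw [interior_Ici]
      intro y hy
      rw [(hMd y hy).deriv]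
      exact hg0 y hy
  have hbdd : BddAbove (meanU U '' Set.Ici Y) := by
    refine ⟨meanU U Y, ?_⟩
    rintro _ ⟨y, hy, rfl⟩
    exact mul_le_mul_of_nonneg_left (hanti (Set.self_mem_Ici) hy hy) (by positivity)
  refine ⟨hbdd, fun y hy => ?_⟩
  have hle : meanU U y ≤ sSup (meanU U '' Set.Ici Y) := le_csSup hbdd ⟨y, hy, rfl⟩
  refine le_trans ?_ (add_le_add_left hle _)
  have cX := (hUx y hy).continuous
  set B := ∫ x in (0:ℝ)..(2 * π), |pderivX U (x, y)| with hB
  have hBle : B ≤ Real.sqrt (2 * π) * L2x U y := by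
    unfold L2x
    rw [← Real.sqrt_mul hpi.le]
    apply Real.le_sqrt_of_sq_le
    have := cc_CS _ cX.abs
    simpa only [sq_abs] using this
  have hpt : ∀ x ∈ Set.Icc 0 (2 * π), U (0, y) ≤ U (x, y) + B := by
    intro x hx
    have h1 : ∫ t in (0:ℝ)..x, pderivX U (t, y) = U (x, y) - U (0, y) :=
      intervalIntegral.integral_eq_sub_of_hasDerivAt (f := fun x => U (x, y))
        (fun x _ => ((hsl y hy).differentiable (by simp) x).hasDerivAt)
        (cX.intervalIntegrable _ _)
    have h2 := intervalIntegral.abs_integral_le_integral_abs (μ := volume)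
      (f := fun t => pderivX U (t, y)) hx.1
    have h3 : ∫ t in (0:ℝ)..x, |pderivX U (t, y)| ≤ B :=
      intervalIntegral.integral_mono_interval le_rfl hx.1 hx.2
        (Filter.Eventually.of_forall fun _ => abs_nonneg _) (cX.abs.intervalIntegrable _ _)
    rw [h1] at h2
    have := (abs_le.1 (h2.trans h3)).1
    linarith
  have hint : ∫ x in (0:ℝ)..(2 * π), U (0, y) ≤ ∫ x in (0:ℝ)..(2 * π), (U (x, y) + B) := by
    have := (hsl y hy).continuous
    exact intervalIntegral.integral_mono_on hpi.le (by simp)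
      ((this.add continuous_const).intervalIntegrable _ _) hpt
  rw [intervalIntegral.integral_add ((hsl y hy).continuous.intervalIntegrable _ _) (by simp)] at hint
  simp only [intervalIntegral.integral_const, sub_zero, smul_eq_mul] at hint
  have : U (0, y) ≤ meanU U y + B := by
    unfold meanU
    rw [one_div, ← sub_le_iff_le_add, inv_mul_eq_div, le_div_iff₀ hpi]
    linarith
  linarith
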